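/- (Taylor expansion of the energy at a ground state.) Assume the Jellium condition. Fix α ∈ ℝ and r ∈ ℝ³. For φ, κ, p as in the definition of B, define ρ^{(2)}(x) := ∑_{n∈Γ_N}[σ(x−n−r−κ(n)) − σ(x−n−r) + κ(n)·∇σ(x−n−r)] − e|φ(x)|², and for N·ℤ³-periodic integrable real functions f, g set (f,Gg) := N^{−3} ∑_{ξ∈Γ*_N\{0}} Re( f̂(ξ)·conj(ĝ(ξ)) )/|ξ|². Then with q(n) := r + κ(n), E(ψ_α+φ, q, p) = B(φ,κ,p) + ½·(2ρ^{(1)}+ρ^{(2)}, Gρ^{(2)}). -/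

import Mathlib

noncomputable section

namespace SPN

open MeasureTheory Finset
open scoped Real

/-- Points of `ℝ³`. -/
abbrev V3 : Type := Fin 3 → ℝ

/-- Euclidean dot product on `ℝ³`. -/
def dotP (v w : V3) : ℝ := ∑ i, v i * w i

/-- Squared Euclidean norm on `ℝ³`. -/
def nsqV (v : V3) : ℝ := ∑ i, v i ^ 2

/-- The fundamental cube `[0,N)³` of the torus `T_N = ℝ³/(N·ℤ³)`. -/
def cubeN (N : ℕ) : Set V3 := {x | ∀ i, x i ∈ Set.Ico (0 : ℝ) (N : ℝ)}

/-- `N·ℤ³`-periodicity of a function on `ℝ³`. -/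
def IsPerN {α : Type*} (N : ℕ) (f : V3 → α) : Prop :=
  ∀ (x : V3) (k : Fin 3 → ℤ), f (x + fun i => (N : ℝ) * (k i : ℝ)) = f x

/-- Index set for `Γ_N = {0,…,N−1}³`. -/
abbrev GammaIdx (N : ℕ) : Type := Fin 3 → Fin N

/-- The lattice point of `Γ_N` associated to an index. -/
def embG {N : ℕ} (n : GammaIdx N) : V3 := fun i => ((n i : ℕ) : ℝ)

/-- Fourier coefficient `f̂(ξ) = ∫_{T_N} e^{iξ·x} f(x) dx`. -/
def fCoeff (N : ℕ) (f : V3 → ℂ) (ξ : V3) : ℂ :=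
  ∫ x in cubeN N, Complex.exp (Complex.I * ((dotP ξ x : ℝ) : ℂ)) * f x

/-- Fourier coefficient of a real-valued function. -/
def fCoeffR (N : ℕ) (f : V3 → ℝ) (ξ : V3) : ℂ :=
  fCoeff N (fun x => ((f x : ℝ) : ℂ)) ξ

/-- The point `(2π/N)·k` of the dual lattice `Γ*_N`. -/
def xiN (N : ℕ) (k : Fin 3 → ℤ) : V3 := fun i => (2 * π / (N : ℝ)) * (k i : ℝ)

/-- The Jellium condition: `σ̂(ξ) = 0` for all `ξ ∈ Γ*_1 \ {0}`. -/
def JelliumCond (N : ℕ) (σ : V3 → ℝ) : Prop :=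
  ∀ k : Fin 3 → ℤ, k ≠ 0 → fCoeffR N σ (fun i => 2 * π * (k i : ℝ)) = 0

/-- `(2π/N)·k ∈ Γ*_1`, i.e. every coordinate of `k` is divisible by `N`. -/
def inGamma1 (N : ℕ) (k : Fin 3 → ℤ) : Prop := ∀ i, (N : ℤ) ∣ k i

/-- `|∇φ(x)|²` for a complex-valued function. -/
def gradSq (φ : V3 → ℂ) (x : V3) : ℝ :=
  ∑ i, Complex.normSq (fderiv ℝ φ x (Pi.single i 1))

/-- Gradient of a real-valued function on `ℝ³`. -/
def gradV (f : V3 → ℝ) (x : V3) : V3 := fun i => fderiv ℝ f x (Pi.single i 1)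

/-- Total charge density `ρ(x) = ∑_n σ(x−n−q(n)) − e|ψ(x)|²`. -/
def rhoT (N : ℕ) (σ : V3 → ℝ) (e : ℝ) (ψ : V3 → ℂ) (q : GammaIdx N → V3) (x : V3) : ℝ :=
  (∑ n : GammaIdx N, σ (x - embG n - q n)) - e * Complex.normSq (ψ x)

/-- `∑_{ξ∈Γ*_N\{0}} |f̂(ξ)|²/|ξ|²`. -/
def dualSum (N : ℕ) (f : V3 → ℝ) : ℝ :=
  ∑' k : Fin 3 → ℤ, if k = 0 then 0 else
    Complex.normSq (fCoeffR N f (xiN N k)) / nsqV (xiN N k)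

/-- The energy functional `E(ψ,q,p)`. -/
def energyE (N : ℕ) (σ : V3 → ℝ) (e M : ℝ) (ψ : V3 → ℂ) (q p : GammaIdx N → V3) : ℝ :=
  (1 / 2) * (∫ x in cubeN N, gradSq ψ x)
    + (2 * (N : ℝ) ^ 3)⁻¹ * dualSum N (rhoT N σ e ψ q)
    + (2 * M)⁻¹ * ∑ n : GammaIdx N, nsqV (p n)

/-- The matrix `Σ(θ) = ∑_{m∈ℤ³} (ξξᵀ/|ξ|²)|σ̂(ξ)|²`, `ξ = θ + 2πm`. -/
def SigMat (N : ℕ) (σ : V3 → ℝ) (θ : V3) : Matrix (Fin 3) (Fin 3) ℝ :=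
  Matrix.of fun a b => ∑' m : Fin 3 → ℤ,
    ((θ a + 2 * π * (m a : ℝ)) * (θ b + 2 * π * (m b : ℝ))
        / nsqV (fun i => θ i + 2 * π * (m i : ℝ)))
      * Complex.normSq (fCoeffR N σ (fun i => θ i + 2 * π * (m i : ℝ)))

/-- The Wiener condition: `Σ(θ)` is positive definite for all `θ ∈ Γ*_N \ Γ*_1`. -/
def WienerCond (N : ℕ) (σ : V3 → ℝ) : Prop :=
  ∀ k : Fin 3 → ℤ, ¬ inGamma1 N k → (SigMat N σ (xiN N k)).PosDef

/-- First-order ionic density `σ⁽¹⁾(x) = −∑_n κ(n)·∇σ(x−n−r)`. -/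
def sigma1F (N : ℕ) (σ : V3 → ℝ) (r : V3) (κ : GammaIdx N → V3) (x : V3) : ℝ :=
  - ∑ n : GammaIdx N, dotP (κ n) (gradV σ (x - embG n - r))

/-- First-order charge density `ρ⁽¹⁾(x) = σ⁽¹⁾(x) − 2e√Z·Re(e^{−iα}φ(x))`. -/
def rho1F (N : ℕ) (σ : V3 → ℝ) (e Z α : ℝ) (r : V3) (κ : GammaIdx N → V3)
    (φ : V3 → ℂ) (x : V3) : ℝ :=
  sigma1F N σ r κ x - 2 * e * Real.sqrt Z * (Complex.exp (-Complex.I * (α : ℂ)) * φ x).re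

/-- The quadratic form `B(φ,κ,p)` (half of the energy Hessian). -/
def BformQ (N : ℕ) (σ : V3 → ℝ) (e Z M α : ℝ) (r : V3)
    (φ : V3 → ℂ) (κ p : GammaIdx N → V3) : ℝ :=
  (1 / 2) * (∫ x in cubeN N, gradSq φ x)
    + (2 * (N : ℝ) ^ 3)⁻¹ * dualSum N (rho1F N σ e Z α r κ φ)
    + (2 * M)⁻¹ * ∑ n : GammaIdx N, nsqV (p n)

/-- Second-order charge density `ρ⁽²⁾`. -/
def rho2F (N : ℕ) (σ : V3 → ℝ) (e : ℝ) (r : V3) (κ : GammaIdx N → V3)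
    (φ : V3 → ℂ) (x : V3) : ℝ :=
  (∑ n : GammaIdx N,
      (σ (x - embG n - r - κ n) - σ (x - embG n - r)
        + dotP (κ n) (gradV σ (x - embG n - r))))
    - e * Complex.normSq (φ x)

/-- The pairing `(f, Gg) = N⁻³ ∑_{ξ∈Γ*_N\{0}} Re(f̂(ξ)·conj(ĝ(ξ)))/|ξ|²`. -/
def GPair (N : ℕ) (f g : V3 → ℝ) : ℝ :=
  ((N : ℝ) ^ 3)⁻¹ * ∑' k : Fin 3 → ℤ, if k = 0 then 0 else
    (fCoeffR N f (xiN N k) * (starRingEnd ℂ) (fCoeffR N g (xiN N k))).re / nsqV (xiN N k)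

/-- The distance to the solitary manifold of ground states. -/
def distS (N : ℕ) (Z : ℝ) (ψ : V3 → ℂ) (q p : GammaIdx N → V3) : ℝ :=
  ⨅ (α : ℝ) (r : V3),
    (Real.sqrt (∫ x in cubeN N,
        (Complex.normSq (ψ x - Complex.exp (Complex.I * (α : ℂ)) * ((Real.sqrt Z : ℝ) : ℂ))
          + gradSq ψ x))
      + Real.sqrt (∑ n : GammaIdx N, ⨅ k : Fin 3 → ℤ,
          nsqV (fun i => q n i - r i - (N : ℝ) * (k i : ℝ)))
      + Real.sqrt (∑ n : GammaIdx N, nsqV (p n)))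

/-- The discrete Fourier transform `κ̂(θ) ∈ ℂ³` of `κ : Γ_N → ℝ³`. -/
def hatK (N : ℕ) (κ : GammaIdx N → V3) (θ : V3) (a : Fin 3) : ℂ :=
  ∑ n : GammaIdx N, Complex.exp (Complex.I * ((dotP θ (embG n) : ℝ) : ℂ)) * ((κ n a : ℝ) : ℂ)

/-- Laplacian of a complex-valued function on `ℝ³`. -/
def lapC (f : V3 → ℂ) (x : V3) : ℂ :=
  ∑ i, fderiv ℝ (fun y => fderiv ℝ f y (Pi.single i 1)) x (Pi.single i 1)

/-- Laplacian of a real-valued function on `ℝ³`. -/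
def lapR (f : V3 → ℝ) (x : V3) : ℝ :=
  ∑ i, fderiv ℝ (fun y => fderiv ℝ f y (Pi.single i 1)) x (Pi.single i 1)

/-- A classical solution of the Schrödinger–Poisson–Newton system on `ℝ`. -/
structure IsSPN (N : ℕ) (σ : V3 → ℝ) (e M : ℝ)
    (ψ : V3 → ℝ → ℂ) (Φ : V3 → ℝ → ℝ) (q : ℝ → GammaIdx N → V3) : Prop where
  per_psi : ∀ t : ℝ, IsPerN N (fun x => ψ x t)
  per_Phi : ∀ t : ℝ, IsPerN N (fun x => Φ x t)
  regx_psi : ∀ t : ℝ, ContDiff ℝ 2 (fun x => ψ x t)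
  regt_psi : ∀ x : V3, ContDiff ℝ 1 (fun t => ψ x t)
  regx_Phi : ∀ t : ℝ, ContDiff ℝ 2 (fun x => Φ x t)
  regt_Phi : ∀ x : V3, ContDiff ℝ 1 (fun t => Φ x t)
  reg_q : ContDiff ℝ 2 q
  schrodinger : ∀ (x : V3) (t : ℝ),
    Complex.I * deriv (fun s => ψ x s) t =
      -(1 / 2 : ℂ) * lapC (fun y => ψ y t) x - ((e : ℝ) : ℂ) * ((Φ x t : ℝ) : ℂ) * ψ x t
  poisson : ∀ (x : V3) (t : ℝ),
    - lapR (fun y => Φ y t) x =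
      (∑ n : GammaIdx N, σ (x - embG n - q t n)) - e * Complex.normSq (ψ x t)
  newton : ∀ (n : GammaIdx N) (t : ℝ) (i : Fin 3),
    M * deriv (fun s => deriv (fun u => q u n i) s) t =
      - ∫ x in cubeN N, fderiv ℝ (fun y => Φ y t) x (Pi.single i 1) * σ (x - embG n - q t n)


/-! ## Helper lemmas -/

lemma cubeN_eq (N : ℕ) : cubeN N = Set.pi Set.univ (fun _ : Fin 3 => Set.Ico (0 : ℝ) (N : ℝ)) := by
  ext x; simp [cubeN]

lemma cubeN_meas (N : ℕ) : MeasurableSet (cubeN N) := by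
  rw [cubeN_eq]; exact MeasurableSet.univ_pi fun _ => measurableSet_Ico

lemma cubeN_sub (N : ℕ) : cubeN N ⊆ Set.Icc (0 : V3) (fun _ => (N : ℝ)) := by
  intro x hx
  exact ⟨fun i => (hx i).1, fun i => (hx i).2.le⟩

lemma cubeN_vol (N : ℕ) : volume (cubeN N) = ENNReal.ofReal ((N : ℝ) ^ 3) := by
  rw [cubeN_eq, volume_pi_pi]
  simp [ENNReal.ofReal_pow]

lemma intOn (N : ℕ) {E : Type*} [NormedAddCommGroup E] {f : V3 → E} (hf : Continuous f) :
    IntegrableOn f (cubeN N) :=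
  (hf.continuousOn.integrableOn_compact isCompact_Icc).mono_set (cubeN_sub N)

lemma cont_dotP (ξ : V3) : Continuous (fun x => dotP ξ x) := by
  unfold dotP; fun_prop

lemma cont_exp (ξ : V3) :
    Continuous (fun x : V3 => Complex.exp (Complex.I * ((dotP ξ x : ℝ) : ℂ))) := by
  have := cont_dotP ξ
  fun_prop

lemma int_trans (N : ℕ) (hN : 0 < N) (F : V3 → ℂ) (hF : IsPerN N F) (a : V3) :
    ∫ x in cubeN N, F (x - a) = ∫ x in cubeN N, F x := by
  have hN' : (N : ℝ) ≠ 0 := by positivity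
  let b : Module.Basis (Fin 3) ℝ V3 := (Pi.basisFun ℝ (Fin 3)).unitsSMul (fun _ => Units.mk0 (N : ℝ) hN')
  have hb : ZSpan.fundamentalDomain b = cubeN N := by
    ext x
    simp only [ZSpan.mem_fundamentalDomain, cubeN, Set.mem_ofPred_eq, b, Module.Basis.repr_unitsSMul,
      Pi.basisFun_repr, Set.mem_Ico]
    refine forall_congr' fun i => ?_
    have hp : (0 : ℝ) < N := by positivity
    simp only [Units.smul_def, Units.val_inv_eq_inv_val, Units.val_mk0, smul_eq_mul]
    rw [inv_mul_lt_iff₀ hp, mul_one, mul_nonneg_iff_of_pos_left (inv_pos.mpr hp)]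
  have hfd : IsAddFundamentalDomain (Submodule.span ℤ (Set.range b)).toAddSubgroup
      (cubeN N) volume := hb ▸ ZSpan.isAddFundamentalDomain' b volume
  have hinv : ∀ (g : (Submodule.span ℤ (Set.range b)).toAddSubgroup) (x : V3), F (g +ᵥ x) = F x := by
    rintro ⟨g, hg⟩ x
    have hg' : g ∈ Submodule.span ℤ (Set.range b) := hg
    rw [Submodule.mem_span_range_iff_exists_fun] at hg'
    obtain ⟨c, hc⟩ := hg'
    have : g = fun i => (N : ℝ) * (c i : ℝ) := by
      rw [← hc]
      ext i
      simp [b, Module.Basis.unitsSMul_apply, Finset.sum_apply, Pi.single_apply, Units.smul_def]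
    show F (g + x) = F x
    rw [add_comm, this]
    exact hF x c
  have hcount : Countable (Submodule.span ℤ (Set.range b)).toAddSubgroup :=
    inferInstanceAs (Countable (Submodule.span ℤ (Set.range b)))
  have hfd2 := hfd.vadd_of_comm (-a)
  have h1 := hfd.setIntegral_eq hfd2 hinv
  rw [h1]
  have hmp := measurePreserving_add_left (volume : Measure V3) (-a)
  have hemb := (MeasurableEquiv.addLeft (-a)).measurableEmbedding
  have := hmp.setIntegral_image_emb hemb F (cubeN N)
  refine Eq.trans ?_ this.symm
  refine integral_congr_ae (Filter.Eventually.of_forall fun x => ?_)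
  simp [sub_eq_neg_add]

lemma dotP_add (ξ x y : V3) : dotP ξ (x + y) = dotP ξ x + dotP ξ y := by
  simp [dotP, mul_add, Finset.sum_add_distrib]

lemma exp_per (N : ℕ) (hN : 0 < N) (k : Fin 3 → ℤ) :
    IsPerN N (fun x : V3 => Complex.exp (Complex.I * ((dotP (xiN N k) x : ℝ) : ℂ))) := by
  intro x m
  have hN' : (N : ℝ) ≠ 0 := by positivity
  have : dotP (xiN N k) (fun i => (N : ℝ) * (m i : ℝ)) = ((∑ i, k i * m i : ℤ) : ℝ) * (2 * π) := by
    simp only [dotP, xiN]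
    push_cast
    rw [Finset.sum_mul]
    refine Finset.sum_congr rfl fun i _ => ?_
    field_simp
  simp only [dotP_add, this]
  rw [show Complex.I * ((dotP (xiN N k) x + ((∑ i, k i * m i : ℤ) : ℝ) * (2 * π) : ℝ) : ℂ)
    = Complex.I * ((dotP (xiN N k) x : ℝ) : ℂ) + ((∑ i, k i * m i : ℤ) : ℂ) * (2 * π * Complex.I) by
      push_cast; ring, Complex.exp_add, Complex.exp_int_mul_two_pi_mul_I, mul_one]

lemma fCoeff_trans (N : ℕ) (hN : 0 < N) (f : V3 → ℂ) (hf : IsPerN N f) (a : V3) (k : Fin 3 → ℤ) :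
    fCoeff N (fun x => f (x - a)) (xiN N k) =
      Complex.exp (Complex.I * ((dotP (xiN N k) a : ℝ) : ℂ)) * fCoeff N f (xiN N k) := by
  have hp : IsPerN N (fun x : V3 => Complex.exp (Complex.I * ((dotP (xiN N k) x : ℝ) : ℂ)) * f x) := by
    intro x m
    have h1 := exp_per N hN k x m
    have h2 := hf x m
    simp only at h1
    simp only [h1, h2]
  unfold fCoeff
  rw [← int_trans N hN _ hp a, ← integral_const_mul]
  refine integral_congr_ae (Filter.Eventually.of_forall fun x => ?_)
  simp only
  rw [← mul_assoc, ← Complex.exp_add]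
  congr 2
  have : dotP (xiN N k) x = dotP (xiN N k) a + dotP (xiN N k) (x - a) := by
    rw [← dotP_add]; simp
  rw [this]; push_cast; ring

lemma exp_int_zero (N : ℕ) (hN : 0 < N) (k : Fin 3 → ℤ) (hk : k ≠ 0) :
    ∫ x in cubeN N, Complex.exp (Complex.I * ((dotP (xiN N k) x : ℝ) : ℂ)) = 0 := by
  have hN' : (N : ℝ) ≠ 0 := by positivity
  obtain ⟨i, hi⟩ := Function.ne_iff.mp hk
  have hi' : (k i : ℝ) ≠ 0 := by exact_mod_cast hi
  have h := fCoeff_trans N hN (fun _ => 1) (fun _ _ => rfl) (Pi.single i ((N : ℝ) / (2 * k i))) k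
  have hd : dotP (xiN N k) (Pi.single i ((N : ℝ) / (2 * k i))) = π := by
    simp [dotP, xiN, Pi.single_apply]
    field_simp
  rw [hd, mul_comm Complex.I, Complex.exp_pi_mul_I] at h
  have : fCoeff N (fun _ => 1) (xiN N k) = 0 := by linear_combination h / 2
  simpa [fCoeff] using this

lemma bessel (N : ℕ) (hN : 0 < N) (f : V3 → ℂ) (hf : Continuous f) :
    Summable (fun k : Fin 3 → ℤ => Complex.normSq (fCoeff N f (xiN N k))) := by
  set μ : Measure V3 := volume.restrict (cubeN N) with hμ
  have hfin : IsFiniteMeasure μ := ⟨by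
    rw [hμ, Measure.restrict_apply_univ, cubeN_vol]; exact ENNReal.ofReal_lt_top⟩
  have mem : ∀ g : V3 → ℂ, Continuous g → MemLp g 2 μ := fun g hg =>
    (memLp_two_iff_integrable_sq_norm hg.aestronglyMeasurable).2 (intOn N (by fun_prop))
  have inn : ∀ (g h : V3 → ℂ) (hg : Continuous g) (hh : Continuous h),
      inner ℂ ((mem g hg).toLp g) ((mem h hh).toLp h) = ∫ x in cubeN N, (starRingEnd ℂ) (g x) * h x := by
    intro g h hg hh
    rw [L2.inner_def]
    refine integral_congr_ae ?_
    filter_upwards [(mem g hg).coeFn_toLp, (mem h hh).coeFn_toLp] with x h1 h2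
    rw [h1, h2]
    simp [mul_comm]
  set c : ℝ := (Real.sqrt ((N : ℝ) ^ 3))⁻¹ with hc
  have hN3 : (0 : ℝ) < (N : ℝ) ^ 3 := by positivity
  have hc0 : c ≠ 0 := by rw [hc]; positivity
  have hcc : c * c * (N : ℝ) ^ 3 = 1 := by
    rw [hc, ← mul_inv, Real.mul_self_sqrt hN3.le, inv_mul_cancel₀ hN3.ne']
  let g : (Fin 3 → ℤ) → V3 → ℂ := fun k x =>
    (c : ℂ) * Complex.exp (-(Complex.I * ((dotP (xiN N k) x : ℝ) : ℂ)))
  have hg : ∀ k, Continuous (g k) := fun k => by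
    have := cont_dotP (xiN N k)
    fun_prop
  have hconj : ∀ k x, (starRingEnd ℂ) (g k x) =
      (c : ℂ) * Complex.exp (Complex.I * ((dotP (xiN N k) x : ℝ) : ℂ)) := by
    intro k x
    simp [g, ← Complex.exp_conj]
  have horth : Orthonormal ℂ (fun k => (mem (g k) (hg k)).toLp (g k)) := by
    classical
    rw [orthonormal_iff_ite]
    intro j k
    rw [inn _ _ (hg j) (hg k)]
    have : ∀ x, (starRingEnd ℂ) (g j x) * g k x =
        ((c * c : ℝ) : ℂ) * Complex.exp (Complex.I * ((dotP (xiN N (j - k)) x : ℝ) : ℂ)) := by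
      intro x
      rw [hconj]
      simp only [g]
      rw [mul_mul_mul_comm, ← Complex.exp_add]
      push_cast
      congr 2
      have : dotP (xiN N (j - k)) x = dotP (xiN N j) x - dotP (xiN N k) x := by
        simp only [dotP, xiN, ← Finset.sum_sub_distrib]
        refine Finset.sum_congr rfl fun i _ => ?_
        push_cast [Pi.sub_apply]; ring
      rw [this]; push_cast; ring
    simp only [this]
    rw [integral_const_mul]
    split_ifs with h
    · subst h
      have h0 : ∀ x, dotP (xiN N (j - j)) x = 0 := fun x => by simp [dotP, xiN]
      simp only [h0]
      simp [Measure.real, cubeN_vol, -Complex.ofReal_mul]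
      exact_mod_cast hcc
    · rw [exp_int_zero N hN _ (sub_ne_zero.mpr h), mul_zero]
  have hs := horth.inner_products_summable ((mem f hf).toLp f)
  have : ∀ k, Complex.normSq (fCoeff N f (xiN N k)) = (c ^ 2)⁻¹ *
      ‖inner ℂ ((mem (g k) (hg k)).toLp (g k)) ((mem f hf).toLp f)‖ ^ 2 := by
    intro k
    rw [inn _ _ (hg k) hf]
    simp only [hconj, mul_assoc]
    rw [integral_const_mul, norm_mul, mul_pow, Complex.normSq_eq_norm_sq]
    simp only [Complex.norm_real, Real.norm_eq_abs, sq_abs]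
    rw [← mul_assoc, inv_mul_cancel₀ (pow_ne_zero 2 hc0), one_mul]
    rfl
  simp only [this]
  exact hs.mul_left _

lemma summ (N : ℕ) (hN : 0 < N) (f : V3 → ℝ) (hf : Continuous f) :
    Summable (fun k : Fin 3 → ℤ => if k = 0 then 0 else
      Complex.normSq (fCoeffR N f (xiN N k)) / nsqV (xiN N k)) := by
  have hN' : (0 : ℝ) < N := by positivity
  have hb := (bessel N hN (fun x => ((f x : ℝ) : ℂ)) (by fun_prop)).mul_left (((2 * π / N) ^ 2)⁻¹)
  have hns : ∀ k : Fin 3 → ℤ, 0 ≤ nsqV (xiN N k) := fun k => by unfold nsqV; positivity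
  refine Summable.of_nonneg_of_le (fun k => ?_) (fun k => ?_) hb
  · split_ifs
    · exact le_rfl
    · exact div_nonneg (Complex.normSq_nonneg _) (hns k)
  · have h0 : 0 ≤ Complex.normSq (fCoeff N (fun x => ((f x : ℝ) : ℂ)) (xiN N k)) :=
      Complex.normSq_nonneg _
    split_ifs with h
    · positivity
    · rw [div_eq_inv_mul]
      refine mul_le_mul_of_nonneg_right ?_ h0
      refine inv_anti₀ (by positivity) ?_
      obtain ⟨i, hi⟩ := Function.ne_iff.mp h
      have h1 : (1 : ℝ) ≤ (k i : ℝ) ^ 2 := by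
        have : 0 < (k i) ^ 2 := by
          have : k i ≠ 0 := hi
          positivity
        exact_mod_cast this
      calc (2 * π / N) ^ 2 ≤ (2 * π / N) ^ 2 * (k i : ℝ) ^ 2 :=
            le_mul_of_one_le_right (by positivity) h1
        _ = (xiN N k i) ^ 2 := by simp [xiN]; ring
        _ ≤ nsqV (xiN N k) := Finset.single_le_sum (f := fun i => (xiN N k i) ^ 2)
            (fun j _ => sq_nonneg _) (Finset.mem_univ i)

lemma fCoeffR_add (N : ℕ) (f g : V3 → ℝ) (hf : Continuous f) (hg : Continuous g) (ξ : V3) :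
    fCoeffR N (fun x => f x + g x) ξ = fCoeffR N f ξ + fCoeffR N g ξ := by
  unfold fCoeffR fCoeff
  have := cont_exp ξ
  rw [← integral_add (intOn N (by fun_prop)) (intOn N (by fun_prop))]
  refine integral_congr_ae (Filter.Eventually.of_forall fun x => ?_)
  simp only
  push_cast; ring

lemma fCoeffR_sum (N : ℕ) {ι : Type*} (s : Finset ι) (f : ι → V3 → ℝ) (hf : ∀ i, Continuous (f i))
    (ξ : V3) : fCoeffR N (fun x => ∑ i ∈ s, f i x) ξ = ∑ i ∈ s, fCoeffR N (f i) ξ := by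
  unfold fCoeffR fCoeff
  have := cont_exp ξ
  rw [← integral_finsetSum _ fun i _ => intOn N (by have := hf i; fun_prop)]
  refine integral_congr_ae (Filter.Eventually.of_forall fun x => ?_)
  simp only
  push_cast
  rw [Finset.mul_sum]

lemma fCoeffR_const (N : ℕ) (hN : 0 < N) (c : ℝ) (k : Fin 3 → ℤ) (hk : k ≠ 0) :
    fCoeffR N (fun _ => c) (xiN N k) = 0 := by
  unfold fCoeffR fCoeff
  rw [integral_mul_const, exp_int_zero N hN k hk, zero_mul]

lemma geom_zero (N : ℕ) (hN : 0 < N) (m : ℤ) (hm : ¬ (N : ℤ) ∣ m) :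
    ∑ j : Fin N, Complex.exp (Complex.I * ((2 * π / N * m * (j : ℕ) : ℝ) : ℂ)) = 0 := by
  have hN' : (N : ℂ) ≠ 0 := by exact_mod_cast hN.ne'
  set ζ : ℂ := Complex.exp (Complex.I * ((2 * π / N * m : ℝ) : ℂ)) with hζ
  have h1 : ∀ j : ℕ, Complex.exp (Complex.I * ((2 * π / N * m * (j : ℕ) : ℝ) : ℂ)) = ζ ^ j := by
    intro j
    rw [hζ, ← Complex.exp_nat_mul]; congr 1; push_cast; ring
  simp only [h1]
  rw [Fin.sum_univ_eq_sum_range (fun j => ζ ^ j) N]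
  have hζN : ζ ^ N = 1 := by
    rw [hζ, ← Complex.exp_nat_mul, Complex.exp_eq_one_iff]
    refine ⟨m, ?_⟩
    push_cast; field_simp
  have hζ1 : ζ ≠ 1 := by
    intro h
    rw [hζ, Complex.exp_eq_one_iff] at h
    obtain ⟨n, hn⟩ := h
    apply hm
    refine ⟨n, ?_⟩
    push_cast at hn
    have hpi : (π : ℂ) ≠ 0 := by exact_mod_cast Real.pi_ne_zero
    have hI := Complex.I_ne_zero
    field_simp at hn
    have : (m : ℂ) = N * n := by linear_combination hn
    exact_mod_cast this
  have := mul_geom_sum ζ N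
  rw [hζN, sub_self] at this
  exact (mul_eq_zero.mp this).resolve_left (sub_ne_zero.mpr hζ1)

lemma rho0_zero (N : ℕ) (hN : 0 < N) (σ : V3 → ℝ) (hper : IsPerN N σ) (hc : Continuous σ)
    (hJ : JelliumCond N σ) (r : V3) (k : Fin 3 → ℤ) (hk : k ≠ 0) :
    fCoeffR N (fun x => ∑ n : GammaIdx N, σ (x - embG n - r)) (xiN N k) = 0 := by
  rw [fCoeffR_sum N _ (fun n x => σ (x - embG n - r)) (fun n => by fun_prop)]
  have h1 : ∀ n : GammaIdx N, fCoeffR N (fun x => σ (x - embG n - r)) (xiN N k) =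
      (∏ i, Complex.exp (Complex.I * ((2 * π / N * k i * (n i : ℕ) : ℝ) : ℂ))) *
      (Complex.exp (Complex.I * ((dotP (xiN N k) r : ℝ) : ℂ)) * fCoeffR N σ (xiN N k)) := by
    intro n
    have := fCoeff_trans N hN (fun x => ((σ x : ℝ) : ℂ))
      (fun x m => by simp only [hper x m]) (embG n + r) k
    unfold fCoeffR
    simp only [← sub_sub] at this
    rw [this, dotP_add, ← mul_assoc, ← Complex.exp_sum, ← Complex.exp_add]
    congr 2
    rw [← Finset.mul_sum]
    simp only [dotP, xiN, embG]
    push_cast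
    ring
  simp only [h1]
  rw [← Finset.sum_mul]
  by_cases hd : ∀ i, (N : ℤ) ∣ k i
  · choose m hm using hd
    have hN' : (N : ℝ) ≠ 0 := by positivity
    have hx : xiN N k = fun i => 2 * π * (m i : ℝ) := by
      ext i
      simp only [xiN, hm i]
      push_cast; field_simp
    have hm0 : m ≠ 0 := by
      rintro rfl
      apply hk; ext i; simp [hm i]
    rw [hx, hJ m hm0]; simp
  · push Not at hd
    obtain ⟨i, hi⟩ := hd
    have := Finset.prod_univ_sum (fun _ : Fin 3 => (Finset.univ : Finset (Fin N)))
      (fun i j => Complex.exp (Complex.I * ((2 * π / N * k i * (j : ℕ) : ℝ) : ℂ)))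
    rw [Fintype.piFinset_univ] at this
    rw [← this, Finset.prod_eq_zero (Finset.mem_univ i) (geom_zero N hN (k i) hi), zero_mul]

/-- Taylor expansion of the energy at a ground state. -/
theorem stmt11 (N : ℕ) (hN : 0 < N) (σ : V3 → ℝ) (e Z M : ℝ)
    (he : 0 < e) (hZ : 0 < Z) (hM : 0 < M)
    (hper : IsPerN N σ) (hreg : ContDiff ℝ 2 σ)
    (hint : (∫ x in cubeN N, σ x) = e * Z)
    (hJ : JelliumCond N σ) (α : ℝ) (r : V3) :
    ∀ (φ : V3 → ℂ) (κ p : GammaIdx N → V3), IsPerN N φ → ContDiff ℝ 1 φ →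
      energyE N σ e M
          (fun x => Complex.exp (Complex.I * (α : ℂ)) * ((Real.sqrt Z : ℝ) : ℂ) + φ x)
          (fun n => r + κ n) p =
        BformQ N σ e Z M α r φ κ p
          + (1 / 2) * GPair N
              (fun x => 2 * rho1F N σ e Z α r κ φ x + rho2F N σ e r κ φ x)
              (fun x => rho2F N σ e r κ φ x) := by
  intro φ κ p hφper hφ
  have hσc : Continuous σ := hreg.continuous
  have hφc : Continuous φ := hφ.continuous
  have hgrad : ∀ i, Continuous (fun x => gradV σ x i) := by
    intro i
    have h := hreg.continuous_fderiv (by norm_num)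
    exact h.clm_apply continuous_const
  have hdot : ∀ v a b : V3, Continuous (fun x => dotP v (gradV σ (x - a - b))) := by
    intro v a b
    unfold dotP
    refine continuous_finsetSum _ fun i _ => continuous_const.mul ?_
    exact (hgrad i).comp (by fun_prop)
  set ρ1 := rho1F N σ e Z α r κ φ with hρ1
  set ρ2 := rho2F N σ e r κ φ with hρ2
  have c1 : Continuous ρ1 := by
    rw [hρ1]
    unfold rho1F sigma1F
    refine ((continuous_finsetSum _ fun n _ => hdot _ _ _).neg).sub ?_
    exact continuous_const.mul (Complex.continuous_re.comp (by fun_prop))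
  have c2 : Continuous ρ2 := by
    rw [hρ2]
    unfold rho2F
    refine (continuous_finsetSum _ fun n _ => ?_).sub ?_
    · exact Continuous.add (by fun_prop) (hdot _ _ _)
    · exact continuous_const.mul (Complex.continuous_normSq.comp hφc)
  have hsq : ∀ z : ℂ, Complex.normSq (Complex.exp (Complex.I * (α : ℂ)) * ((Real.sqrt Z : ℝ) : ℂ) + z)
      = Z + 2 * Real.sqrt Z * (Complex.exp (-Complex.I * (α : ℂ)) * z).re + Complex.normSq z := by
    intro z
    rw [Complex.normSq_add, Complex.normSq_mul, Complex.normSq_ofReal, Real.mul_self_sqrt hZ.le]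
    have h1 : Complex.normSq (Complex.exp (Complex.I * (α : ℂ))) = 1 := by
      rw [Complex.normSq_eq_norm_sq, mul_comm, Complex.norm_exp_ofReal_mul_I, one_pow]
    have h2 : Complex.exp (-Complex.I * (α : ℂ)) =
        (starRingEnd ℂ) (Complex.exp (Complex.I * (α : ℂ))) := by
      rw [← Complex.exp_conj]; simp
    rw [h1, h2]
    simp [Complex.mul_re]
    ring
  set ρT := rhoT N σ e
    (fun x => Complex.exp (Complex.I * (α : ℂ)) * ((Real.sqrt Z : ℝ) : ℂ) + φ x)
    (fun n => r + κ n) with hρT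
  have hdec : ρT = fun x => ((∑ n : GammaIdx N, σ (x - embG n - r)) + (-(e * Z))) + (ρ1 x + ρ2 x) := by
    funext x
    simp only [hρT, hρ1, hρ2, rhoT, rho1F, rho2F, sigma1F, hsq, Finset.sum_add_distrib,
      Finset.sum_sub_distrib, ← sub_sub]
    ring
  have hF : ∀ k : Fin 3 → ℤ, k ≠ 0 → fCoeffR N ρT (xiN N k) =
      fCoeffR N ρ1 (xiN N k) + fCoeffR N ρ2 (xiN N k) := by
    intro k hk
    have cS : Continuous fun x => ∑ n : GammaIdx N, σ (x - embG n - r) := by fun_prop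
    rw [hdec, fCoeffR_add N (fun x => (∑ n : GammaIdx N, σ (x - embG n - r)) + (-(e * Z)))
      (fun x => ρ1 x + ρ2 x) (cS.add continuous_const) (c1.add c2),
      fCoeffR_add N _ _ cS continuous_const, fCoeffR_add N _ _ c1 c2,
      rho0_zero N hN σ hper hσc hJ r k hk, fCoeffR_const N hN _ k hk]
    ring
  have cT : Continuous ρT := by
    rw [hdec]; fun_prop
  have hF2 : ∀ k : Fin 3 → ℤ, fCoeffR N (fun x => 2 * ρ1 x + ρ2 x) (xiN N k) =
      2 * fCoeffR N ρ1 (xiN N k) + fCoeffR N ρ2 (xiN N k) := by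
    intro k
    have : (fun x => 2 * ρ1 x + ρ2 x) = fun x => ρ1 x + (ρ1 x + ρ2 x) := by
      funext x; ring
    rw [this, fCoeffR_add N ρ1 (fun x => ρ1 x + ρ2 x) c1 (c1.add c2), fCoeffR_add N _ _ c1 c2]
    ring
  have hterm : ∀ k : Fin 3 → ℤ, (if k = 0 then (0 : ℝ) else
      (fCoeffR N (fun x => 2 * ρ1 x + ρ2 x) (xiN N k) *
        (starRingEnd ℂ) (fCoeffR N (fun x => ρ2 x) (xiN N k))).re / nsqV (xiN N k)) =
      (if k = 0 then 0 else Complex.normSq (fCoeffR N ρT (xiN N k)) / nsqV (xiN N k)) -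
      (if k = 0 then 0 else Complex.normSq (fCoeffR N ρ1 (xiN N k)) / nsqV (xiN N k)) := by
    intro k
    split_ifs with h
    · simp
    · rw [hF k h, hF2 k, ← sub_div]
      congr 1
      simp only [Complex.normSq_apply, Complex.mul_re, Complex.mul_im, Complex.add_re,
        Complex.add_im, Complex.conj_re, Complex.conj_im, Complex.re_ofNat, Complex.im_ofNat]
      ring
  have hG : GPair N (fun x => 2 * ρ1 x + ρ2 x) (fun x => ρ2 x) =
      ((N : ℝ) ^ 3)⁻¹ * (dualSum N ρT - dualSum N ρ1) := by
    unfold GPair dualSum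
    rw [← (summ N hN ρT cT).tsum_sub (summ N hN ρ1 c1)]
    congr 1
    exact tsum_congr hterm
  have hgr : ∀ x, gradSq
      (fun x => Complex.exp (Complex.I * (α : ℂ)) * ((Real.sqrt Z : ℝ) : ℂ) + φ x) x
      = gradSq φ x := by
    intro x
    unfold gradSq
    rw [fderiv_const_add]
  unfold energyE BformQ
  rw [hG, ← hρT, ← hρ1]
  simp only [hgr]
  rw [mul_inv]
  ring

end SPN
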